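/- arXiv:2401.16574 — 2 statements merged into one kernel-verified Lean document; each statement's English description precedes it below -/
import Mathlib

section
/- Under the RA model (W row-stochastic but not necessarily irreducible): for every maximal communication class C of the network, almost surely the subvector (x_{t,i})_{i∈C} converges as t → ∞, and its limit is either the all-zeros vector or the all-ones vector indexed by C. -/
open MeasureTheory ProbabilityTheory Filter

namespace RA

variable {Ω : Type*}

/-- History σ-algebra generated by `x 1, …, x t` and `a 1, …, a (t-1)`. -/
def hist {N : ℕ} [MeasurableSpace Ω] (x a : ℕ → Ω → Fin N → ℝ) (t : ℕ) :
    MeasurableSpace Ω :=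
  (⨆ s ∈ Finset.Icc 1 t, MeasurableSpace.comap (x s) inferInstance) ⊔
  (⨆ s ∈ Finset.Ico 1 t, MeasurableSpace.comap (a s) inferInstance)

/-- The Random Actions (RA) opinion dynamics model. -/
structure IsRAModel {N : ℕ} [MeasurableSpace Ω] (μ : Measure Ω) (α : ℝ)
    (W : Matrix (Fin N) (Fin N) ℝ) (x a : ℕ → Ω → Fin N → ℝ) : Prop where
  isProb : IsProbabilityMeasure μ
  alpha_mem : α ∈ Set.Ioo (0 : ℝ) 1
  W_nonneg : ∀ i j, 0 ≤ W i j
  W_rowsum : ∀ i, ∑ j, W i j = 1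
  x_meas : ∀ t, Measurable (x t)
  a_meas : ∀ t, Measurable (a t)
  x_mem : ∀ t, 1 ≤ t → ∀ ω i, x t ω i ∈ Set.Icc (0 : ℝ) 1
  a_mem : ∀ t, 1 ≤ t → ∀ ω i, a t ω i = 0 ∨ a t ω i = 1
  update : ∀ t, 1 ≤ t → ∀ ω i,
    x (t + 1) ω i = (1 - α) * x t ω i + α * ∑ j, W i j * a t ω j
  bernoulli : ∀ t, 1 ≤ t → ∀ b : Fin N → Bool, ∀ H : Set Ω,
    MeasurableSet[hist x a t] H →
    (μ (H ∩ {ω | ∀ i, a t ω i = if b i then (1 : ℝ) else 0})).toReal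
      = ∫ ω in H, ∏ i, (if b i then x t ω i else 1 - x t ω i) ∂μ

/-- `W` is irreducible: the network is strongly connected. -/
def Irreducible {N : ℕ} (W : Matrix (Fin N) (Fin N) ℝ) : Prop :=
  ∀ i j, ∃ n : ℕ, 0 < (W ^ n) i j

/-- The event that `x t i ∈ [0,δ) ∪ (1-δ,1]`. -/
def cti {N : ℕ} (x : ℕ → Ω → Fin N → ℝ) (δ : ℝ) (t : ℕ) (i : Fin N) : Set Ω :=
  {ω | x t ω i < δ ∨ 1 - δ < x t ω i}

def ct {N : ℕ} (x : ℕ → Ω → Fin N → ℝ) (δ : ℝ) (t : ℕ) : Set Ω :=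
  ⋂ i, cti x δ t i

def c0 {N : ℕ} (x : ℕ → Ω → Fin N → ℝ) (δ : ℝ) (t : ℕ) (i : Fin N) : Set Ω :=
  {ω | x t ω i < δ}

def c1 {N : ℕ} (x : ℕ → Ω → Fin N → ℝ) (δ : ℝ) (t : ℕ) (i : Fin N) : Set Ω :=
  {ω | 1 - δ < x t ω i}

/-- The event that every coordinate of `x t` is within `δ` of `0`. -/
def corner0 {N : ℕ} (x : ℕ → Ω → Fin N → ℝ) (δ : ℝ) (t : ℕ) : Set Ω :=
  {ω | ∀ i, x t ω i < δ}

/-- The event that every coordinate of `x t` is within `δ` of `1`. -/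
def corner1 {N : ℕ} (x : ℕ → Ω → Fin N → ℝ) (δ : ℝ) (t : ℕ) : Set Ω :=
  {ω | ∀ i, 1 - δ < x t ω i}

/-- Agents `i` and `j` communicate. -/
def Communicates {N : ℕ} (W : Matrix (Fin N) (Fin N) ℝ) (i j : Fin N) : Prop :=
  (∃ n : ℕ, 0 < (W ^ n) j i) ∧ (∃ n : ℕ, 0 < (W ^ n) i j)

/-- `C` is a communication class (strongly connected component). -/
def CommClass {N : ℕ} (W : Matrix (Fin N) (Fin N) ℝ) (C : Set (Fin N)) : Prop :=
  ∃ i, C = {j | Communicates W i j}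

/-- `C` is a maximal communication class: no agent outside `C` has a directed
path into `C`. -/
def IsMaximalClass {N : ℕ} (W : Matrix (Fin N) (Fin N) ℝ) (C : Set (Fin N)) : Prop :=
  CommClass W C ∧ ∀ i ∈ C, ∀ j, (∃ n : ℕ, 0 < (W ^ n) i j) → j ∈ C

section Network

variable {N : ℕ} {W : Matrix (Fin N) (Fin N) ℝ}

/-- A property that propagates along the positive entries of a nonnegative matrix propagates along
the positive entries of its powers. -/
lemma propagate_of_pow_pos (hW : ∀ i j, 0 ≤ W i j) {P : Fin N → Prop}
    (hP : ∀ i k, P i → 0 < W i k → P k) (n : ℕ) :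
    ∀ i j, P i → 0 < (W ^ n) i j → P j := by
  induction n with
  | zero =>
    intro i j hi hij
    rw [pow_zero, Matrix.one_apply] at hij
    split_ifs at hij with h
    · exact h ▸ hi
    · exact absurd hij (lt_irrefl 0)
  | succ n ih =>
    intro i j hi hij
    rw [pow_succ', Matrix.mul_apply] at hij
    obtain ⟨k, -, hk⟩ := Finset.exists_lt_of_sum_lt (by simpa using hij :
      ∑ _k : Fin N, (0 : ℝ) < ∑ k, W i k * (W ^ n) k j)
    have hWk : 0 < W i k := (hW i k).lt_of_ne' fun h => by simp [h] at hk
    exact ih k j (hP i k hi hWk) (pos_of_mul_pos_right hk hWk.le)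

lemma IsMaximalClass.eq_zero_of_notMem (hW : ∀ i j, 0 ≤ W i j) {C : Set (Fin N)}
    (hC : IsMaximalClass W C) {i j : Fin N} (hi : i ∈ C) (hj : j ∉ C) : W i j = 0 := by
  by_contra h
  exact hj (hC.2 i hi j ⟨1, by simpa using (hW i j).lt_of_ne' h⟩)

/-- A row-stochastic matrix has a nonzero nonnegative stationary vector supported on any nonempty
set of states that the chain cannot leave. -/
lemma exists_stationary (hW : ∀ i j, 0 ≤ W i j) (hrow : ∀ i, ∑ j, W i j = 1)
    {C : Set (Fin N)} (hclosed : ∀ i ∈ C, ∀ j ∉ C, W i j = 0) {r : Fin N} (hr : r ∈ C) :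
    ∃ p : Fin N → ℝ, (∀ i, 0 ≤ p i) ∧ (∀ j, ∑ i, p i * W i j = p j) ∧ ∃ i ∈ C, 0 < p i := by
  classical
  let V : Matrix (Fin N) (Fin N) ℝ :=
    Matrix.of fun i j => if i ∈ C then W i j else if j = r then 1 else 0
  have hV : ∀ i j, 0 ≤ V i j := by
    intro i j; simp only [V, Matrix.of_apply]; split_ifs <;> first | exact hW i j | norm_num
  have hVrow : ∀ i, ∑ j, V i j = 1 := by
    intro i; by_cases hi : i ∈ C <;> simp [V, hi, hrow]
  have hVout : ∀ i, ∀ j ∉ C, V i j = 0 := by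
    intro i j hj
    have hjr : j ≠ r := fun h => hj (h ▸ hr)
    by_cases hi : i ∈ C
    · simp [V, hi, hclosed i hi j hj]
    · simp [V, hi, hjr]
  have hdet : (V - 1).det = 0 := by
    rw [← Matrix.exists_mulVec_eq_zero_iff]
    refine ⟨fun _ => 1, fun h => by simpa using congrFun h r, ?_⟩
    ext i
    rw [Matrix.sub_mulVec, Matrix.one_mulVec]
    simp [Matrix.mulVec, dotProduct, hVrow i]
  obtain ⟨v, hv0, hv⟩ := Matrix.exists_vecMul_eq_zero_iff.mpr hdet
  have hfix : ∀ j, ∑ i, v i * V i j = v j := by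
    intro j
    have := congrFun hv j
    simp only [Matrix.vecMul_sub, Matrix.vecMul_one, Pi.sub_apply, Pi.zero_apply] at this
    exact sub_eq_zero.mp this
  have hvout : ∀ j ∉ C, v j = 0 := by
    intro j hj
    rw [← hfix j]
    exact Finset.sum_eq_zero fun i _ => by rw [hVout i j hj, mul_zero]
  have hle : ∀ j, |v j| ≤ ∑ i, |v i| * V i j := by
    intro j
    conv_lhs => rw [← hfix j]
    refine (Finset.abs_sum_le_sum_abs _ _).trans_eq (Finset.sum_congr rfl fun i _ => ?_)
    rw [abs_mul, abs_of_nonneg (hV i j)]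
  have htot : ∑ j, |v j| = ∑ j, ∑ i, |v i| * V i j := by
    rw [Finset.sum_comm]
    simp [← Finset.mul_sum, hVrow]
  have heq := (Finset.sum_eq_sum_iff_of_le fun j _ => hle j).mp htot
  refine ⟨fun i => |v i|, fun i => abs_nonneg _, fun j => ?_, ?_⟩
  · refine Eq.trans ?_ (heq j (Finset.mem_univ j)).symm
    refine Finset.sum_congr rfl fun i _ => ?_
    by_cases hi : i ∈ C
    · simp [V, hi]
    · simp [hvout i hi]
  · obtain ⟨i, hi⟩ := Function.ne_iff.mp hv0
    exact ⟨i, by_contra fun h => hi (hvout i h), abs_pos.mpr hi⟩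

/-- A maximal class carries a stationary vector which is positive on the whole class. -/
lemma IsMaximalClass.exists_stationary_pos (hW : ∀ i j, 0 ≤ W i j) (hrow : ∀ i, ∑ j, W i j = 1)
    {C : Set (Fin N)} (hC : IsMaximalClass W C) :
    ∃ p : Fin N → ℝ, (∀ i, 0 ≤ p i) ∧ (∀ j, ∑ i, p i * W i j = p j) ∧ ∀ i ∈ C, 0 < p i := by
  have hclosed : ∀ i ∈ C, ∀ j ∉ C, W i j = 0 := fun i hi j hj => hC.eq_zero_of_notMem hW hi hj
  obtain ⟨⟨r, rfl⟩, -⟩ := hC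
  obtain ⟨p, hp, hfix, i, hi, hpi⟩ := exists_stationary hW hrow hclosed
    (show r ∈ {j | Communicates W r j} from ⟨⟨0, by simp⟩, ⟨0, by simp⟩⟩)
  have hstep : ∀ i k, 0 < p i → 0 < W i k → 0 < p k := fun i k hi hk =>
    calc 0 < p i * W i k := mul_pos hi hk
      _ ≤ ∑ i, p i * W i k := Finset.single_le_sum (f := fun i => p i * W i k)
        (fun i _ => mul_nonneg (hp i) (hW i k)) (Finset.mem_univ i)
      _ = p k := hfix k
  obtain ⟨⟨n, hn⟩, -⟩ := hi
  refine ⟨p, hp, hfix, fun j hj => ?_⟩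
  obtain ⟨-, ⟨m, hm⟩⟩ := hj
  exact propagate_of_pow_pos hW hstep m r j (propagate_of_pow_pos hW hstep n i r hpi hn) hm

/-- A nonnegative function which is harmonic on a maximal class and vanishes at some point of the
class vanishes on the class. -/
lemma IsMaximalClass.harmonic_eq_zero (hW : ∀ i j, 0 ≤ W i j) {C : Set (Fin N)}
    (hC : IsMaximalClass W C) {u : Fin N → ℝ} (hu : ∀ i ∈ C, 0 ≤ u i)
    (hfix : ∀ i ∈ C, ∑ j, W i j * u j = u i) {i : Fin N} (hi : i ∈ C) (hui : u i = 0) :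
    ∀ j ∈ C, u j = 0 := by
  have hclosed : ∀ i ∈ C, ∀ j ∉ C, W i j = 0 := fun i hi j hj => hC.eq_zero_of_notMem hW hi hj
  have hstep : ∀ i k, (i ∈ C ∧ u i = 0) → 0 < W i k → (k ∈ C ∧ u k = 0) := by
    rintro i k ⟨hi, hui⟩ hk
    have hkC : k ∈ C := by_contra fun h => hk.ne' (hclosed i hi k h)
    refine ⟨hkC, ?_⟩
    have h0 := (Finset.sum_eq_zero_iff_of_nonneg fun j _ => ?_).mp ((hfix i hi).trans hui) k
      (Finset.mem_univ k)
    · exact (mul_eq_zero.mp h0).resolve_left hk.ne'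
    · by_cases hj : j ∈ C
      · exact mul_nonneg (hW i j) (hu j hj)
      · simp [hclosed i hi j hj]
  obtain ⟨⟨r, rfl⟩, -⟩ := hC
  intro j hj
  obtain ⟨n, hn⟩ := hi.1
  obtain ⟨m, hm⟩ := hj.2
  exact (propagate_of_pow_pos hW hstep m r j
    (propagate_of_pow_pos hW hstep n i r ⟨hi, hui⟩ hn) hm).2

/-- If the actions and the opinions in a maximal class become asymptotically equal, then the
opinions in that class reach consensus at `0` or at `1`. -/
lemma IsMaximalClass.tendsto_extreme_of_sub_tendsto_zero (hW : ∀ i j, 0 ≤ W i j)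
    (hrow : ∀ i, ∑ j, W i j = 1) {C : Set (Fin N)} (hC : IsMaximalClass W C)
    {α : ℝ} (hα : α ∈ Set.Ioo (0 : ℝ) 1) {y b : ℕ → Fin N → ℝ}
    (hy : ∀ t i, y t i ∈ Set.Icc (0 : ℝ) 1) (hb : ∀ t i, b t i = 0 ∨ b t i = 1)
    (hstep : ∀ t i, y (t + 1) i = (1 - α) * y t i + α * ∑ j, W i j * b t j)
    (hsub : ∀ i ∈ C, Tendsto (fun t => b t i - y t i) atTop (nhds 0)) :
    (∀ i ∈ C, Tendsto (fun t => y t i) atTop (nhds 0)) ∨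
      (∀ i ∈ C, Tendsto (fun t => y t i) atTop (nhds 1)) := by
  have hlim : ∀ i, ∃ c : ℝ, i ∈ C → (c = 0 ∨ c = 1) ∧ (∀ᶠ t in atTop, b t i = c) ∧
      Tendsto (fun t => y t i) atTop (nhds c) := by
    intro i
    by_cases hi : i ∈ C
    swap
    · exact ⟨0, fun h => absurd h hi⟩
    have hε : 0 < (1 - α) / 2 := by linarith [hα.2]
    obtain ⟨T, hT⟩ := (Metric.tendsto_atTop.mp (hsub i hi)) _ hε
    have hconst : ∀ t ≥ T, b t i = b T i := by
      intro t ht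
      induction t, ht using Nat.le_induction with
      | base => rfl
      | succ t ht ih =>
        rw [← ih]
        have h1 := hT t ht
        have h2 := hT (t + 1) (by omega)
        rw [Real.dist_eq, sub_zero, abs_lt] at h1 h2
        have hs0 : 0 ≤ ∑ j, W i j * b t j := Finset.sum_nonneg fun j _ =>
          mul_nonneg (hW i j) (by rcases hb t j with h | h <;> simp [h])
        have hs1 : ∑ j, W i j * b t j ≤ 1 := by
          rw [← hrow i]
          exact Finset.sum_le_sum fun j _ =>
            mul_le_of_le_one_right (hW i j) (by rcases hb t j with h | h <;> simp [h])
        have hys := hstep t i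
        have hy1 := hy t i
        have hup : y (t + 1) i - y t i ≤ α := by
          nlinarith [mul_nonneg hα.1.le hy1.1, mul_le_mul_of_nonneg_left hs1 hα.1.le]
        have hlo : -α ≤ y (t + 1) i - y t i := by
          nlinarith [mul_le_mul_of_nonneg_left hy1.2 hα.1.le, mul_nonneg hα.1.le hs0]
        rcases hb t i with h | h <;> rcases hb (t + 1) i with h' | h' <;> rw [h, h'] <;>
          rw [h] at h1 <;> rw [h'] at h2 <;> exfalso <;> linarith [h1.1, h1.2, h2.1, h2.2]
    have hev : ∀ᶠ t in atTop, b t i = b T i := eventually_atTop.mpr ⟨T, hconst⟩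
    refine ⟨b T i, fun _ => ⟨hb T i, hev, ?_⟩⟩
    have h := (tendsto_const_nhds (x := b T i)).sub (hsub i hi)
    rw [sub_zero] at h
    refine h.congr' ?_
    filter_upwards [hev] with t ht
    rw [ht]; ring
  choose c hc using hlim
  have hfix : ∀ i ∈ C, ∑ j, W i j * c j = c i := by
    intro i hi
    have hev : ∀ᶠ t in atTop, ∑ j, W i j * b t j = ∑ j, W i j * c j := by
      have : ∀ᶠ t in atTop, ∀ j, j ∈ C → b t j = c j := by
        rw [eventually_all]
        intro j
        by_cases hj : j ∈ C
        · filter_upwards [(hc j hj).2.1] with t ht _ using ht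
        · exact Eventually.of_forall fun t h => absurd h hj
      filter_upwards [this] with t ht
      refine Finset.sum_congr rfl fun j _ => ?_
      by_cases hj : j ∈ C
      · rw [ht j hj]
      · simp [hC.eq_zero_of_notMem hW hi hj]
    have h1 := (hc i hi).2.2
    have h2 : Tendsto (fun t => y (t + 1) i) atTop
        (nhds ((1 - α) * c i + α * ∑ j, W i j * c j)) := by
      refine ((h1.const_mul (1 - α)).add_const (α * ∑ j, W i j * c j)).congr' ?_
      filter_upwards [hev] with t ht
      rw [hstep, ht]
    have h3 := tendsto_nhds_unique h2 (h1.comp (tendsto_add_atTop_nat 1))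
    have h4 : α * (∑ j, W i j * c j - c i) = 0 := by linarith
    exact sub_eq_zero.mp ((mul_eq_zero.mp h4).resolve_left hα.1.ne')
  have hr : ∃ r, r ∈ C := by
    obtain ⟨⟨r, rfl⟩, -⟩ := hC
    exact ⟨r, ⟨0, by simp⟩, ⟨0, by simp⟩⟩
  obtain ⟨r, hr⟩ := hr
  rcases (hc r hr).1 with h | h
  · left
    intro i hi
    have h0 := hC.harmonic_eq_zero hW
      (fun i hi => by rcases (hc i hi).1 with h | h <;> simp [h]) hfix hr h i hi
    exact h0 ▸ (hc i hi).2.2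
  · right
    intro i hi
    have h0 := hC.harmonic_eq_zero hW (u := fun i => 1 - c i)
      (fun i hi => by rcases (hc i hi).1 with h | h <;> simp [h])
      (fun i hi => by simp [mul_sub, Finset.sum_sub_distrib, hrow, hfix i hi]) hr
      (by simp [h]) i hi
    have h1 : c i = 1 := by linarith
    exact h1 ▸ (hc i hi).2.2

end Network

/-- The probability of the profile `b` under independent Bernoulli coordinates with means `y`,
weighted by a centred coordinate and a function that does not depend on that coordinate, sums to
zero. -/
lemma sum_centred_mul_prod_eq_zero {N : ℕ} (y : Fin N → ℝ) (j : Fin N)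
    (h : (Fin N → Bool) → ℝ) (hh : ∀ b, h (Function.update b j (!b j)) = h b) :
    ∑ b : Fin N → Bool, h b * ((if b j then 1 else 0) - y j) *
      ∏ i, (if b i then y i else 1 - y i) = 0 := by
  have hrest : ∀ b : Fin N → Bool,
      ∏ i ∈ Finset.univ.erase j, (if (Function.update b j (!b j)) i then y i else 1 - y i) =
        ∏ i ∈ Finset.univ.erase j, (if b i then y i else 1 - y i) := fun b =>
    Finset.prod_congr rfl fun i hi => by
      rw [Function.update_of_ne (Finset.ne_of_mem_erase hi)]
  refine Finset.sum_involution (fun b _ => Function.update b j (!b j)) ?_ ?_ ?_ ?_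
  · intro b _
    rw [← Finset.mul_prod_erase _ _ (Finset.mem_univ j),
      ← Finset.mul_prod_erase Finset.univ
        (fun i => if (Function.update b j (!b j)) i then y i else 1 - y i) (Finset.mem_univ j),
      hrest, hh, Function.update_self]
    cases b j <;> simp <;> ring
  · intro b _ _ hb
    simpa using congrFun hb j
  · simp
  · intro b _
    simp

namespace IsRAModel

variable [MeasurableSpace Ω] {N : ℕ} {μ : Measure Ω} {α : ℝ}
  {W : Matrix (Fin N) (Fin N) ℝ} {x a : ℕ → Ω → Fin N → ℝ}

lemma hist_le (hRA : IsRAModel μ α W x a) (t : ℕ) : hist x a t ≤ ‹MeasurableSpace Ω› :=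
  sup_le (iSup₂_le fun s _ => (hRA.x_meas s).comap_le)
    (iSup₂_le fun s _ => (hRA.a_meas s).comap_le)

lemma measurable_hist {t : ℕ} (ht : 1 ≤ t) (i : Fin N) :
    Measurable[hist x a t] fun ω => x t ω i := by
  have h : MeasurableSpace.comap (x t) inferInstance ≤ hist x a t :=
    le_sup_of_le_left (le_iSup₂_of_le t (Finset.mem_Icc.mpr ⟨ht, le_rfl⟩) le_rfl)
  exact (measurable_pi_apply i).comp ((comap_measurable (x t)).mono h le_rfl)

/-- The event that the action profile at time `t` is `b`. -/
def actionEvent (a : ℕ → Ω → Fin N → ℝ) (t : ℕ) (b : Fin N → Bool) : Set Ω :=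
  {ω | ∀ i, a t ω i = if b i then (1 : ℝ) else 0}

lemma measurableSet_actionEvent (hRA : IsRAModel μ α W x a) (t : ℕ) (b : Fin N → Bool) :
    MeasurableSet (actionEvent a t b) := by
  rw [actionEvent, Set.ofPred_forall]
  exact MeasurableSet.iInter fun i =>
    ((measurable_pi_apply i).comp (hRA.a_meas t)) (measurableSet_singleton _)

lemma integral_mul_indicator_actionEvent (hRA : IsRAModel μ α W x a) {t : ℕ} (ht : 1 ≤ t)
    (b : Fin N → Bool) {Z : Ω → ℝ} (hZ : Measurable[hist x a t] Z) {K : ℝ}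
    (hK : ∀ ω, |Z ω| ≤ K) :
    ∫ ω, Z ω * (actionEvent a t b).indicator (fun _ => 1) ω ∂μ =
      ∫ ω, Z ω * ∏ i, (if b i then x t ω i else 1 - x t ω i) ∂μ := by
  have := hRA.isProb
  have hm := hRA.hist_le t
  have hA := hRA.measurableSet_actionEvent t b
  set I : Ω → ℝ := (actionEvent a t b).indicator (fun _ => 1) with hI
  set P : Ω → ℝ := fun ω => ∏ i, (if b i then x t ω i else 1 - x t ω i)
  have hPm : Measurable[hist x a t] P := by
    refine Finset.measurable_fun_prod _ fun i _ => ?_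
    by_cases hbi : b i
    · simpa [hbi] using measurable_hist ht i
    · simpa [hbi] using (measurable_hist (x := x) (a := a) ht i).const_sub 1
  have hP0 : ∀ ω, 0 ≤ P ω := fun ω => Finset.prod_nonneg fun i _ => by
    have := hRA.x_mem t ht ω i
    split_ifs <;> linarith [this.1, this.2]
  have hP1 : ∀ ω, P ω ≤ 1 := fun ω => Finset.prod_le_one
    (fun i _ => by have := hRA.x_mem t ht ω i; split_ifs <;> linarith [this.1, this.2])
    (fun i _ => by have := hRA.x_mem t ht ω i; split_ifs <;> linarith [this.1, this.2])
  have hIint : Integrable I μ := (integrable_const 1).indicator hA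
  have hPint : Integrable P μ := Integrable.of_bound (hPm.mono hm le_rfl).aestronglyMeasurable 1
    (Eventually.of_forall fun ω => by rw [Real.norm_eq_abs, abs_of_nonneg (hP0 ω)]; exact hP1 ω)
  have hcond : P =ᵐ[μ] μ[I | hist x a t] := by
    refine ae_eq_condExp_of_forall_setIntegral_eq hm hIint (fun s _ _ => hPint.integrableOn)
      (fun s hs _ => ?_) hPm.stronglyMeasurable.aestronglyMeasurable
    rw [← hRA.bernoulli t ht b s hs, hI, setIntegral_indicator hA]
    simp [Measure.real, actionEvent]
  have hZI : Integrable (Z * I) μ := by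
    refine hIint.bdd_mul (c := K) (hZ.mono hm le_rfl).aestronglyMeasurable
      (Eventually.of_forall fun ω => hK ω)
  calc ∫ ω, Z ω * I ω ∂μ = ∫ ω, (μ[Z * I | hist x a t]) ω ∂μ := (integral_condExp hm).symm
    _ = ∫ ω, Z ω * P ω ∂μ := by
      refine integral_congr_ae ?_
      filter_upwards [condExp_mul_of_stronglyMeasurable_left hZ.stronglyMeasurable hZI hIint,
        hcond] with ω h1 h2
      rw [h1, Pi.mul_apply, h2]

/-- A centred action is orthogonal to every bounded function of the history and of the actions of
the other agents. -/
lemma integral_mul_centred_eq_zero (hRA : IsRAModel μ α W x a) {t : ℕ} (ht : 1 ≤ t) (j : Fin N)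
    {F : Ω → ℝ} {Z : (Fin N → Bool) → Ω → ℝ}
    (hF : ∀ b, ∀ ω ∈ actionEvent a t b, F ω = Z b ω)
    (hZ : ∀ b, Measurable[hist x a t] (Z b)) {K : ℝ} (hK : ∀ b ω, |Z b ω| ≤ K)
    (hZj : ∀ b, Z (Function.update b j (!b j)) = Z b) :
    ∫ ω, F ω * (a t ω j - x t ω j) ∂μ = 0 := by
  classical
  have := hRA.isProb
  have hm := hRA.hist_le t
  let G : (Fin N → Bool) → Ω → ℝ := fun b ω => Z b ω * ((if b j then 1 else 0) - x t ω j)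
  have hGm : ∀ b, Measurable[hist x a t] (G b) := fun b =>
    (hZ b).mul ((measurable_hist ht j).const_sub _)
  have hGK : ∀ b ω, |G b ω| ≤ K := by
    intro b ω
    have hx := hRA.x_mem t ht ω j
    rw [abs_mul]
    refine (mul_le_of_le_one_right (abs_nonneg _) ?_).trans (hK b ω)
    rw [abs_le]
    split_ifs <;> constructor <;> linarith [hx.1, hx.2]
  have hsum : ∀ ω, F ω * (a t ω j - x t ω j) =
      ∑ b, G b ω * (actionEvent a t b).indicator (fun _ => 1) ω := by
    intro ω
    let b₀ : Fin N → Bool := fun i => decide (a t ω i = 1)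
    have hb₀ : ω ∈ actionEvent a t b₀ := fun i => by
      rcases hRA.a_mem t ht ω i with h | h <;> simp [b₀, h]
    rw [Finset.sum_eq_single b₀]
    · rw [Set.indicator_of_mem hb₀, mul_one, hF b₀ ω hb₀, hb₀ j]
    · intro b _ hb
      rw [Set.indicator_of_notMem, mul_zero]
      intro hω
      refine hb (funext fun i => ?_)
      have h1 := hω i
      rw [hb₀ i] at h1
      cases h2 : b i <;> cases h3 : b₀ i <;> simp_all
    · simp
  have hint : ∀ b, Integrable (fun ω => G b ω) μ := fun b =>
    Integrable.of_bound ((hGm b).mono hm le_rfl).aestronglyMeasurable K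
      (Eventually.of_forall fun ω => hGK b ω)
  have hintI : ∀ b, Integrable
      (fun ω => G b ω * (actionEvent a t b).indicator (fun _ => (1 : ℝ)) ω) μ := fun b => by
    refine ((hint b).indicator (hRA.measurableSet_actionEvent t b)).congr
      (Eventually.of_forall fun ω => ?_)
    by_cases hω : ω ∈ actionEvent a t b <;> simp [hω]
  have hintP : ∀ b, Integrable
      (fun ω => G b ω * ∏ i, (if b i then x t ω i else 1 - x t ω i)) μ := fun b => by
    refine (hint b).mul_bdd (c := 1) ?_ (Eventually.of_forall fun ω => ?_)
    · refine (Finset.measurable_fun_prod _ fun i _ => ?_).aestronglyMeasurable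
      have hxi : Measurable fun ω => x t ω i := (measurable_pi_apply i).comp (hRA.x_meas t)
      by_cases hbi : b i
      · simpa [hbi] using hxi
      · simpa [hbi] using hxi.const_sub 1
    · rw [norm_prod]
      refine Finset.prod_le_one (fun i _ => norm_nonneg _) fun i _ => ?_
      have hx := hRA.x_mem t ht ω i
      rw [Real.norm_eq_abs, abs_le]
      split_ifs <;> constructor <;> linarith [hx.1, hx.2]
  simp_rw [hsum]
  rw [integral_finsetSum _ fun b _ => hintI b]
  simp_rw [fun b => hRA.integral_mul_indicator_actionEvent ht b (hGm b) (hGK b)]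
  rw [← integral_finsetSum _ fun b _ => hintP b]
  refine integral_eq_zero_of_ae (Eventually.of_forall fun ω => ?_)
  exact sum_centred_mul_prod_eq_zero (x t ω) j (fun b => Z b ω) fun b => congrFun (hZj b) ω

lemma abs_centred_le_one (hRA : IsRAModel μ α W x a) {t : ℕ} (ht : 1 ≤ t) (ω : Ω) (j : Fin N) :
    |a t ω j - x t ω j| ≤ 1 := by
  have hx := hRA.x_mem t ht ω j
  rw [abs_le]
  rcases hRA.a_mem t ht ω j with h | h <;> rw [h] <;> constructor <;> linarith [hx.1, hx.2]

lemma measurable_x_apply (hRA : IsRAModel μ α W x a) (t : ℕ) (j : Fin N) :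
    Measurable fun ω => x t ω j := (measurable_pi_apply j).comp (hRA.x_meas t)

lemma measurable_a_apply (hRA : IsRAModel μ α W x a) (t : ℕ) (j : Fin N) :
    Measurable fun ω => a t ω j := (measurable_pi_apply j).comp (hRA.a_meas t)

/-- The second moment of the stationary average grows by the weighted variances of the actions. -/
lemma integral_sq_succ (hRA : IsRAModel μ α W x a) {p : Fin N → ℝ}
    (hfix : ∀ j, ∑ i, p i * W i j = p j) {t : ℕ} (ht : 1 ≤ t) :
    ∫ ω, (∑ i, p i * x (t + 1) ω i) ^ 2 ∂μ = ∫ ω, (∑ i, p i * x t ω i) ^ 2 ∂μ +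
      ∑ j, (α * p j) ^ 2 * ∫ ω, (a t ω j - x t ω j) ^ 2 ∂μ := by
  classical
  have := hRA.isProb
  have hstep : ∀ ω, ∑ i, p i * x (t + 1) ω i =
      ∑ i, p i * x t ω i + ∑ j, α * p j * (a t ω j - x t ω j) := by
    intro ω
    have h1 : ∑ i, p i * ∑ j, W i j * a t ω j = ∑ j, p j * a t ω j := by
      simp_rw [Finset.mul_sum]
      rw [Finset.sum_comm]
      refine Finset.sum_congr rfl fun j _ => ?_
      rw [← hfix j, Finset.sum_mul]
      exact Finset.sum_congr rfl fun i _ => by ring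
    have h2 : ∑ i, p i * x (t + 1) ω i =
        (1 - α) * ∑ i, p i * x t ω i + α * ∑ i, p i * ∑ j, W i j * a t ω j := by
      rw [Finset.mul_sum, Finset.mul_sum, ← Finset.sum_add_distrib]
      exact Finset.sum_congr rfl fun i _ => by rw [hRA.update t ht]; ring
    rw [h2, h1, Finset.mul_sum, Finset.mul_sum, ← Finset.sum_add_distrib, ← Finset.sum_add_distrib]
    exact Finset.sum_congr rfl fun i _ => by ring
  let R : Fin N → Ω → ℝ := fun j ω => α * p j * (2 * ∑ i, p i * x t ω i +
    ∑ k ∈ Finset.univ.erase j, α * p k * (a t ω k - x t ω k))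
  have hexp : ∀ ω, (∑ i, p i * x (t + 1) ω i) ^ 2 = (∑ i, p i * x t ω i) ^ 2 +
      ∑ j, (R j ω * (a t ω j - x t ω j) + (α * p j) ^ 2 * (a t ω j - x t ω j) ^ 2) := by
    intro ω
    have h : ∀ j, R j ω * (a t ω j - x t ω j) + (α * p j) ^ 2 * (a t ω j - x t ω j) ^ 2 =
        (2 * ∑ i, p i * x t ω i + ∑ k, α * p k * (a t ω k - x t ω k)) *
          (α * p j * (a t ω j - x t ω j)) := by
      intro j
      rw [← Finset.add_sum_erase Finset.univ (fun k => α * p k * (a t ω k - x t ω k))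
        (Finset.mem_univ j)]
      simp only [R]
      ring
    simp_rw [h]
    rw [← Finset.mul_sum, hstep]
    ring
  let B : ℝ := 2 * ∑ i, |p i| + ∑ k, |α * p k|
  have hMb : ∀ ω, |∑ i, p i * x t ω i| ≤ ∑ i, |p i| := fun ω =>
    (Finset.abs_sum_le_sum_abs _ _).trans <| Finset.sum_le_sum fun i _ => by
      have hx := hRA.x_mem t ht ω i
      rw [abs_mul, abs_of_nonneg hx.1]
      exact mul_le_of_le_one_right (abs_nonneg _) hx.2
  have hbound : ∀ (j : Fin N) (ω : Ω) (d : Fin N → ℝ), (∀ k, |d k| ≤ 1) →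
      |α * p j * (2 * ∑ i, p i * x t ω i + ∑ k ∈ Finset.univ.erase j, α * p k * d k)| ≤
        |α * p j| * B := by
    intro j ω d hd
    rw [abs_mul]
    refine mul_le_mul_of_nonneg_left ((abs_add_le _ _).trans (add_le_add ?_ ?_)) (abs_nonneg _)
    · rw [abs_mul, abs_two]
      exact mul_le_mul_of_nonneg_left (hMb ω) zero_le_two
    · refine (Finset.abs_sum_le_sum_abs _ _).trans ((Finset.sum_le_sum fun k _ => ?_).trans
        (Finset.sum_le_univ_sum_of_nonneg fun k => abs_nonneg _))
      rw [abs_mul]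
      exact mul_le_of_le_one_right (abs_nonneg _) (hd k)
  have hzero : ∀ j, ∫ ω, R j ω * (a t ω j - x t ω j) ∂μ = 0 := by
    intro j
    refine hRA.integral_mul_centred_eq_zero ht j (K := |α * p j| * B)
      (Z := fun b ω => α * p j * (2 * ∑ i, p i * x t ω i +
        ∑ k ∈ Finset.univ.erase j, α * p k * ((if b k then 1 else 0) - x t ω k))) ?_ ?_ ?_ ?_
    · intro b ω hω
      have hω' : ∀ k, a t ω k = if b k then 1 else 0 := hω
      simp only [R, hω']
    · intro b
      refine Measurable.const_mul (Measurable.add (Measurable.const_mul ?_ _) ?_) _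
      · exact Finset.measurable_fun_sum _ fun i _ => (measurable_hist ht i).const_mul _
      · exact Finset.measurable_fun_sum _ fun i _ =>
          ((measurable_hist ht i).const_sub _).const_mul _
    · intro b ω
      refine hbound j ω _ fun k => ?_
      have hx := hRA.x_mem t ht ω k
      rw [abs_le]
      split_ifs <;> constructor <;> linarith [hx.1, hx.2]
    · intro b
      funext ω
      have : ∀ k ∈ Finset.univ.erase j,
          α * p k * ((if (Function.update b j (!b j)) k then 1 else 0) - x t ω k) =
            α * p k * ((if b k then 1 else 0) - x t ω k) := fun k hk => by
        rw [Function.update_of_ne (Finset.ne_of_mem_erase hk)]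
      rw [Finset.sum_congr rfl this]
  have hxm := fun j => hRA.measurable_x_apply t j
  have ham := fun j => hRA.measurable_a_apply t j
  have hMint : Integrable (fun ω => (∑ i, p i * x t ω i) ^ 2) μ := by
    refine Integrable.of_bound (Measurable.aestronglyMeasurable (by fun_prop))
      ((∑ i, |p i|) ^ 2) (Eventually.of_forall fun ω => ?_)
    rw [norm_pow]
    exact pow_le_pow_left₀ (norm_nonneg _) (hMb ω) 2
  have hdint : ∀ j, Integrable (fun ω => (a t ω j - x t ω j) ^ 2) μ := fun j => by
    refine Integrable.of_bound (Measurable.aestronglyMeasurable (by fun_prop))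
      1 (Eventually.of_forall fun ω => ?_)
    rw [norm_pow]
    exact pow_le_one₀ (norm_nonneg _) (hRA.abs_centred_le_one ht ω j)
  have hRint : ∀ j, Integrable (fun ω => R j ω * (a t ω j - x t ω j)) μ := fun j => by
    refine Integrable.of_bound (Measurable.aestronglyMeasurable (by fun_prop))
      (|α * p j| * B) (Eventually.of_forall fun ω => ?_)
    rw [norm_mul]
    exact (mul_le_of_le_one_right (norm_nonneg _) (hRA.abs_centred_le_one ht ω j)).trans
      (hbound j ω _ fun k => hRA.abs_centred_le_one ht ω k)
  have hTint : ∀ j, Integrable (fun ω => R j ω * (a t ω j - x t ω j) +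
      (α * p j) ^ 2 * (a t ω j - x t ω j) ^ 2) μ := fun j =>
    (hRint j).add ((hdint j).const_mul _)
  simp_rw [hexp]
  rw [integral_add hMint (integrable_finsetSum _ fun j _ => hTint j),
    integral_finsetSum _ fun j _ => hTint j]
  congr 1
  refine Finset.sum_congr rfl fun j _ => ?_
  rw [integral_add (hRint j) ((hdint j).const_mul _), hzero, zero_add, integral_const_mul]

/-- Actions and opinions become asymptotically equal at every agent charged by a stationary
vector. -/
lemma ae_tendsto_sub_zero (hRA : IsRAModel μ α W x a) {p : Fin N → ℝ}
    (hfix : ∀ j, ∑ i, p i * W i j = p j) {j : Fin N} (hj : 0 < p j) :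
    ∀ᵐ ω ∂μ, Tendsto (fun t => a (t + 1) ω j - x (t + 1) ω j) atTop (nhds 0) := by
  have := hRA.isProb
  set M : ℕ → ℝ := fun t => ∫ ω, (∑ i, p i * x (t + 1) ω i) ^ 2 ∂μ with hM
  set V : ℕ → ℝ := fun t => ∫ ω, (a (t + 1) ω j - x (t + 1) ω j) ^ 2 ∂μ with hV
  have hVM : ∀ t, (α * p j) ^ 2 * V t ≤ M (t + 1) - M t := by
    intro t
    rw [hM, hV]
    simp only
    rw [hRA.integral_sq_succ hfix (Nat.le_add_left 1 t), add_sub_cancel_left]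
    exact Finset.single_le_sum
      (f := fun j => (α * p j) ^ 2 * ∫ ω, (a (t + 1) ω j - x (t + 1) ω j) ^ 2 ∂μ)
      (fun k _ => mul_nonneg (sq_nonneg _) (integral_nonneg fun ω => sq_nonneg _))
      (Finset.mem_univ j)
  have hM0 : ∀ t, 0 ≤ M t := fun t => integral_nonneg fun ω => sq_nonneg _
  have hMle : ∀ t, M t ≤ (∑ i, |p i|) ^ 2 := by
    intro t
    have hb : ∀ ω, (∑ i, p i * x (t + 1) ω i) ^ 2 ≤ (∑ i, |p i|) ^ 2 := by
      intro ω
      refine sq_le_sq' ?_ ?_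
      all_goals
        have h : |∑ i, p i * x (t + 1) ω i| ≤ ∑ i, |p i| :=
          (Finset.abs_sum_le_sum_abs _ _).trans <| Finset.sum_le_sum fun i _ => by
            have hx := hRA.x_mem (t + 1) (Nat.le_add_left 1 t) ω i
            rw [abs_mul, abs_of_nonneg hx.1]
            exact mul_le_of_le_one_right (abs_nonneg _) hx.2
      · exact (abs_le.mp h).1
      · exact (abs_le.mp h).2
    calc M t ≤ ∫ _, (∑ i, |p i|) ^ 2 ∂μ := integral_mono_of_nonneg
          (Eventually.of_forall fun ω => sq_nonneg _) (integrable_const _)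
          (Eventually.of_forall hb)
      _ = (∑ i, |p i|) ^ 2 := by simp
  have hc : 0 < (α * p j) ^ 2 := pow_pos (mul_pos hRA.alpha_mem.1 hj) 2
  have hsumV : ∀ n, ∑ t ∈ Finset.range n, V t ≤ (∑ i, |p i|) ^ 2 / (α * p j) ^ 2 := by
    intro n
    rw [le_div_iff₀' hc, Finset.mul_sum]
    calc ∑ t ∈ Finset.range n, (α * p j) ^ 2 * V t
        ≤ ∑ t ∈ Finset.range n, (M (t + 1) - M t) := Finset.sum_le_sum fun t _ => hVM t
      _ = M n - M 0 := Finset.sum_range_sub M n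
      _ ≤ (∑ i, |p i|) ^ 2 := by linarith [hMle n, hM0 0]
  have hxm := fun t => hRA.measurable_x_apply t j
  have ham := fun t => hRA.measurable_a_apply t j
  have hmeas : ∀ t, Measurable fun ω =>
      ENNReal.ofReal ((a (t + 1) ω j - x (t + 1) ω j) ^ 2) := fun t => by
    fun_prop
  have hlin : ∀ t, ∫⁻ ω, ENNReal.ofReal ((a (t + 1) ω j - x (t + 1) ω j) ^ 2) ∂μ =
      ENNReal.ofReal (V t) := by
    intro t
    refine (ofReal_integral_eq_lintegral_ofReal ?_
      (Eventually.of_forall fun ω => sq_nonneg _)).symm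
    refine Integrable.of_bound (Measurable.aestronglyMeasurable (by fun_prop))
      1 (Eventually.of_forall fun ω => ?_)
    rw [norm_pow]
    exact pow_le_one₀ (norm_nonneg _) (hRA.abs_centred_le_one (Nat.le_add_left 1 t) ω j)
  have hfin : ∫⁻ ω, ∑' t, ENNReal.ofReal ((a (t + 1) ω j - x (t + 1) ω j) ^ 2) ∂μ ≠ ⊤ := by
    rw [lintegral_tsum fun t => (hmeas t).aemeasurable]
    simp_rw [hlin]
    refine ne_top_of_le_ne_top ENNReal.ofReal_ne_top (ENNReal.tsum_le_of_sum_range_le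
      (c := ENNReal.ofReal ((∑ i, |p i|) ^ 2 / (α * p j) ^ 2)) fun n => ?_)
    rw [← ENNReal.ofReal_sum_of_nonneg fun t _ => integral_nonneg fun ω => sq_nonneg _]
    exact ENNReal.ofReal_le_ofReal (hsumV n)
  filter_upwards [ae_lt_top (Measurable.tsum hmeas) hfin] with ω hω
  have h := ENNReal.tendsto_atTop_zero_of_tsum_ne_top hω.ne
  have h2 := (ENNReal.tendsto_toReal ENNReal.zero_ne_top).comp h
  have h3 : Tendsto (fun t => (a (t + 1) ω j - x (t + 1) ω j) ^ 2) atTop (nhds 0) := by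
    refine h2.congr fun t => ?_
    simp [ENNReal.toReal_ofReal (sq_nonneg _)]
  have h4 := h3.sqrt
  simp_rw [Real.sqrt_sq_eq_abs, Real.sqrt_zero] at h4
  exact (tendsto_zero_iff_abs_tendsto_zero _).mpr h4

end IsRAModel

theorem maximal_class_converges_to_extreme {Ω : Type*} [MeasurableSpace Ω] {N : ℕ} (hN : 1 ≤ N)
    (μ : Measure Ω) (α : ℝ) (W : Matrix (Fin N) (Fin N) ℝ)
    (x a : ℕ → Ω → Fin N → ℝ) (hRA : IsRAModel μ α W x a) :
    ∀ C : Set (Fin N), IsMaximalClass W C →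
      ∀ᵐ ω ∂μ,
        (∀ i ∈ C, Filter.Tendsto (fun t => x t ω i) Filter.atTop (nhds 0))
        ∨ (∀ i ∈ C, Filter.Tendsto (fun t => x t ω i) Filter.atTop (nhds 1)) := by
  intro C hC
  obtain ⟨p, -, hfix, hpos⟩ := hC.exists_stationary_pos hRA.W_nonneg hRA.W_rowsum
  have hsub : ∀ᵐ ω ∂μ, ∀ i, i ∈ C →
      Tendsto (fun t => a (t + 1) ω i - x (t + 1) ω i) atTop (nhds 0) := by
    rw [ae_all_iff]
    intro i
    by_cases hi : i ∈ C
    · filter_upwards [hRA.ae_tendsto_sub_zero hfix (hpos i hi)] with ω hω _ using hω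
    · exact Eventually.of_forall fun ω h => absurd h hi
  filter_upwards [hsub] with ω hω
  have h := hC.tendsto_extreme_of_sub_tendsto_zero hRA.W_nonneg hRA.W_rowsum hRA.alpha_mem
    (y := fun t => x (t + 1) ω) (b := fun t => a (t + 1) ω)
    (fun t i => hRA.x_mem (t + 1) (Nat.le_add_left 1 t) ω i)
    (fun t i => hRA.a_mem (t + 1) (Nat.le_add_left 1 t) ω i)
    (fun t i => hRA.update (t + 1) (Nat.le_add_left 1 t) ω i) hω
  exact h.imp (fun h i hi => (tendsto_add_atTop_iff_nat 1).mp (h i hi))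
    (fun h i hi => (tendsto_add_atTop_iff_nat 1).mp (h i hi))

end RA
end

section
/- Let β ∈ (0,1/2], let β_t = β·2^{−t} for t ≥ 1, and let W_t be the 2×2 matrix with diagonal entries 1−β_t and off-diagonal entries β_t. Then the product c = ∏_{t=1}^∞ (1 − 2β_t) converges to a strictly positive real number, the matrix products W_T W_{T−1} ··· W_1 converge as T → ∞ to the matrix P = (1/2)·[[1+c, 1−c],[1−c, 1+c]], and consequently for every x_0 ∈ ℝ² with x_{0,1} ≠ x_{0,2}, the limit lim_{T→∞} x_T = P x_0 of the iteration x_{t+1} = W_{t+1} x_t has two distinct coordinates, i.e., the time-variant averaging dynamics does not reach consensus. -/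
open Matrix Filter

/-- The time-variant symmetric averaging matrix with mixing parameter `β / 2 ^ t`. -/
noncomputable def Wmat (β : ℝ) (t : ℕ) : Matrix (Fin 2) (Fin 2) ℝ :=
  !![1 - β / 2 ^ t, β / 2 ^ t; β / 2 ^ t, 1 - β / 2 ^ t]

/-- The ordered matrix product `W_T ⋯ W_2 W_1`. -/
noncomputable def Mprod (β : ℝ) : ℕ → Matrix (Fin 2) (Fin 2) ℝ
  | 0 => 1
  | T + 1 => Wmat β (T + 1) * Mprod β T

theorem Mprod_eq (β : ℝ) (T : ℕ) :
    Mprod β T = (1/2 : ℝ) •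
      !![1 + ∏ t ∈ Finset.Icc 1 T, (1 - 2 * (β / 2 ^ t)),
        1 - ∏ t ∈ Finset.Icc 1 T, (1 - 2 * (β / 2 ^ t));
        1 - ∏ t ∈ Finset.Icc 1 T, (1 - 2 * (β / 2 ^ t)),
        1 + ∏ t ∈ Finset.Icc 1 T, (1 - 2 * (β / 2 ^ t))] := by
  induction T with
  | zero => ext i j; fin_cases i <;> fin_cases j <;> norm_num [Mprod]
  | succ T ih =>
    rw [Mprod, ih, Finset.prod_Icc_succ_top (by omega)]
    ext i j
    fin_cases i <;> fin_cases j <;> simp [Wmat, Matrix.mul_apply, Fin.sum_univ_two] <;> ring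

theorem one_sub_inv_two_pow_le {β : ℝ} (hβ : β ≤ 1/2) (t : ℕ) :
    1 - (1/2 : ℝ) ^ t ≤ 1 - 2 * (β / 2 ^ t) := by
  have h : (0 : ℝ) < (1/2) ^ t := by positivity
  have e : β / 2 ^ t = β * (1/2) ^ t := by rw [one_div, inv_pow, div_eq_mul_inv]
  rw [e]
  nlinarith

theorem quarter_add_le_prod {β : ℝ} (hβ : β ≤ 1/2) (T : ℕ) :
    1/4 + (1/2 : ℝ) ^ (T + 2) ≤ ∏ t ∈ Finset.Icc 1 (T + 1), (1 - 2 * (β / 2 ^ t)) := by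
  induction T with
  | zero => norm_num; linarith
  | succ T ih =>
    rw [Finset.prod_Icc_succ_top (by omega)]
    have hpos : (0 : ℝ) < (1/2) ^ (T + 2) := by positivity
    have hle : (1/2 : ℝ) ^ (T + 2) ≤ 1/4 := by
      have := pow_le_one₀ (n := T) (by norm_num : (0 : ℝ) ≤ 1/2) (by norm_num)
      rw [pow_add]
      linarith
    calc 1/4 + (1/2 : ℝ) ^ (T + 1 + 2)
        = 1/4 + (1/2 : ℝ) ^ (T + 2) * (1/2) := by ring
      _ ≤ (1/4 + (1/2 : ℝ) ^ (T + 2)) * (1 - (1/2) ^ (T + 2)) := by nlinarith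
      _ ≤ _ := mul_le_mul ih (one_sub_inv_two_pow_le hβ _) (by linarith)
        (le_trans (by positivity) ih)

theorem quarter_le_prod {β : ℝ} (hβ : β ≤ 1/2) (T : ℕ) :
    1/4 ≤ ∏ t ∈ Finset.Icc 1 T, (1 - 2 * (β / 2 ^ t)) := by
  cases T with
  | zero => norm_num
  | succ T => exact (le_add_of_nonneg_right (by positivity)).trans (quarter_add_le_prod hβ T)

theorem antitone_prod {β : ℝ} (hβ : β ∈ Set.Ioc (0 : ℝ) (1/2)) :
    Antitone fun T : ℕ => ∏ t ∈ Finset.Icc 1 T, (1 - 2 * (β / 2 ^ t)) := by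
  refine antitone_nat_of_succ_le fun T => ?_
  rw [Finset.prod_Icc_succ_top (by omega)]
  have h : 0 ≤ β / 2 ^ (T + 1) := div_nonneg hβ.1.le (by positivity)
  exact mul_le_of_le_one_right (le_trans (by norm_num) (quarter_le_prod hβ.2 T)) (by linarith)

theorem time_variant_averaging_no_consensus (β : ℝ)
    (hβ : β ∈ Set.Ioc (0 : ℝ) (1/2)) :
    ∃ c : ℝ, 0 < c ∧
      Filter.Tendsto (fun T => ∏ t ∈ Finset.Icc 1 T, (1 - 2 * (β / 2 ^ t)))
        Filter.atTop (nhds c) ∧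
      Filter.Tendsto (fun T => Mprod β T) Filter.atTop
        (nhds ((1/2 : ℝ) • !![1 + c, 1 - c; 1 - c, 1 + c])) ∧
      ∀ x0 : Fin 2 → ℝ, x0 0 ≠ x0 1 →
        Filter.Tendsto (fun T => Mprod β T *ᵥ x0) Filter.atTop
          (nhds (((1/2 : ℝ) • !![1 + c, 1 - c; 1 - c, 1 + c]) *ᵥ x0)) ∧
        (((1/2 : ℝ) • !![1 + c, 1 - c; 1 - c, 1 + c]) *ᵥ x0) 0
          ≠ (((1/2 : ℝ) • !![1 + c, 1 - c; 1 - c, 1 + c]) *ᵥ x0) 1 := by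
  have hbdd : BddBelow (Set.range fun T : ℕ => ∏ t ∈ Finset.Icc 1 T, (1 - 2 * (β / 2 ^ t))) :=
    ⟨1/4, Set.forall_mem_range.2 (quarter_le_prod hβ.2)⟩
  obtain ⟨c, hc⟩ : ∃ c, Tendsto (fun T : ℕ => ∏ t ∈ Finset.Icc 1 T, (1 - 2 * (β / 2 ^ t)))
      atTop (nhds c) := ⟨_, tendsto_atTop_ciInf (antitone_prod hβ) hbdd⟩
  have hpos : 0 < c := lt_of_lt_of_le (by norm_num) (ge_of_tendsto' hc (quarter_le_prod hβ.2))
  have hcont : Continuous fun p : ℝ =>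
      (1/2 : ℝ) • (!![1 + p, 1 - p; 1 - p, 1 + p] : Matrix (Fin 2) (Fin 2) ℝ) := by
    refine continuous_matrix fun i j => ?_
    fin_cases i <;> fin_cases j <;> simp <;> fun_prop
  have hM : Tendsto (fun T => Mprod β T) atTop
      (nhds ((1/2 : ℝ) • !![1 + c, 1 - c; 1 - c, 1 + c])) := by
    simp only [Mprod_eq]
    exact (hcont.tendsto c).comp hc
  refine ⟨c, hpos, hc, hM, fun x0 hx => ⟨?_, fun h => ?_⟩⟩
  · exact ((continuous_id.matrix_mulVec continuous_const).tendsto _).comp hM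
  · simp only [Matrix.mulVec, dotProduct, Fin.sum_univ_two, Matrix.smul_apply, Matrix.of_apply,
      Matrix.cons_val_zero, Matrix.cons_val_one, smul_eq_mul] at h
    have h0 : c * (x0 0 - x0 1) = 0 := by linear_combination h
    exact mul_ne_zero hpos.ne' (sub_ne_zero.2 hx) h0
end
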